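/- If for every type σ the property All_σ holds (for all variables f : σB and x : σ, {∀σ f} ⊢ f x), then the proof system is complete: every valid formula is deducible. -/

import Mathlib

namespace PTT


/-- Simple types over a single base type `B`. -/
inductive Ty : Type
  | base : Ty
  | arrow : Ty → Ty → Ty
deriving DecidableEq

/-- Names: the constants `⊥` and `→`, and variables (an index together with a type). -/
inductive Name : Type
  | bot : Name
  | imp : Name
  | var : ℕ → Ty → Name
deriving DecidableEq

/-- The type of a name. -/
def Name.ty : Name → Ty
  | .bot => .base
  | .imp => .arrow .base (.arrow .base .base)
  | .var _ σ => σ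

/-- Terms: names, abstraction over a variable, application. -/
inductive Tm : Type
  | name : Name → Tm
  | lam : ℕ → Ty → Tm → Tm
  | app : Tm → Tm → Tm
deriving DecidableEq

/-- The term `⊥`. -/
def botTm : Tm := .name .bot

/-- The variable `(n, σ)` as a term. -/
def vr (n : ℕ) (σ : Ty) : Tm := .name (.var n σ)

/-- Implication `s → t`. -/
def impTm (s t : Tm) : Tm := .app (.app (.name .imp) s) t

/-- `⊤ := ⊥ → ⊥`. -/
def topTm : Tm := impTm botTm botTm

/-- `¬ s := s → ⊥`. -/
def negTm (s : Tm) : Tm := impTm s botTm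

/-- `s ∨ t := (s → t) → t`. -/
def orTm (s t : Tm) : Tm := impTm (impTm s t) t

/-- `s ∧ t := ¬(¬s ∨ ¬t)`. -/
def andTm (s t : Tm) : Tm := negTm (orTm (negTm s) (negTm t))

/-- `s ≡ t := (s → t) ∧ (t → s)`. -/
def equivTm (s t : Tm) : Tm := andTm (impTm s t) (impTm t s)

/-- The typing relation. -/
inductive HasTy : Tm → Ty → Prop
  | name (x : Name) : HasTy (.name x) x.ty
  | lam {n σ s τ} : HasTy s τ → HasTy (.lam n σ s) (.arrow σ τ)
  | app {s t σ τ} : HasTy s (.arrow σ τ) → HasTy t σ → HasTy (.app s t) τ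

/-- Free variables of a term. -/
def fv : Tm → Finset (ℕ × Ty)
  | .name (.var n σ) => {(n, σ)}
  | .name _ => ∅
  | .lam n σ s => (fv s).erase (n, σ)
  | .app s t => fv s ∪ fv t

/-- A term is closed if it has no free variables. -/
def Closed (s : Tm) : Prop := fv s = ∅

/-- Capture-free parallel substitution (bound variables are renamed). -/
def substAux (ρ : ℕ × Ty → Tm) : Tm → Tm
  | .name (.var n σ) => ρ (n, σ)
  | .name x => .name x
  | .app s t => .app (substAux ρ s) (substAux ρ t)
  | .lam n σ s =>
      let used : Finset ℕ :=
        ((fv s).erase (n, σ)).biUnion (fun p => (fv (ρ p)).image Prod.fst)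
      let m : ℕ := used.sup id + 1
      .lam m σ (substAux (Function.update ρ (n, σ) (vr m σ)) s)

/-- Capture-free substitution `s[(n,σ) := t]`. -/
def subst (s : Tm) (n : ℕ) (σ : Ty) (t : Tm) : Tm :=
  substAux (Function.update (fun p => vr p.1 p.2) (n, σ) t) s

/-- Contexts: terms with exactly one hole (possibly under binders). -/
inductive Ctx : Type
  | hole : Ctx
  | lam : ℕ → Ty → Ctx → Ctx
  | appL : Ctx → Tm → Ctx
  | appR : Tm → Ctx → Ctx

/-- Filling the hole of a context with a term (capturing is allowed). -/
def Ctx.fill : Ctx → Tm → Tm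
  | .hole, s => s
  | .lam n σ C, s => .lam n σ (C.fill s)
  | .appL C t, s => .app (C.fill s) t
  | .appR t C, s => .app t (C.fill s)

/-- `C` captures the variable `p` if the hole of `C` lies below a binder for `p`. -/
def Ctx.captures : Ctx → ℕ × Ty → Prop
  | .hole, _ => False
  | .lam n σ C, p => p = (n, σ) ∨ C.captures p
  | .appL C _, p => C.captures p
  | .appR _ C, p => C.captures p

/-- `C` is admissible for `A` if it captures no variable free in `A`. -/
def Ctx.Admissible (C : Ctx) (A : Finset Tm) : Prop :=
  ∀ p ∈ A.biUnion fv, ¬ C.captures p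

/-- `s` is a subterm of `t`. -/
def Subterm (s t : Tm) : Prop := ∃ C : Ctx, C.fill s = t

/-- β-redexes. -/
def IsBetaRedex : Tm → Prop
  | .app (.lam _ _ _) _ => True
  | _ => False

/-- A term is β-normal if none of its subterms is a β-redex. -/
def BetaNormal (t : Tm) : Prop := ∀ s, Subterm s t → ¬ IsBetaRedex s

/-- Lambda equivalence: the least equivalence on well-typed terms containing
α-, β-, η-conversion and closed under arbitrary contexts. -/
inductive LamEq : Tm → Tm → Prop
  | refl {s σ} : HasTy s σ → LamEq s s
  | symm {s t} : LamEq s t → LamEq t s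
  | trans {s t u} : LamEq s t → LamEq t u → LamEq s u
  | alpha {n m σ s τ} : HasTy (.lam n σ s) τ → (m, σ) ∉ fv s →
      LamEq (.lam n σ s) (.lam m σ (subst s n σ (vr m σ)))
  | beta {n σ s t τ} : HasTy (.app (.lam n σ s) t) τ →
      LamEq (.app (.lam n σ s) t) (subst s n σ t)
  | eta {n σ s τ} : HasTy (.lam n σ (.app s (vr n σ))) τ → (n, σ) ∉ fv s →
      LamEq (.lam n σ (.app s (vr n σ))) s
  | ctx {s t σ} (C : Ctx) : LamEq s t → HasTy (C.fill s) σ → LamEq (C.fill s) (C.fill t)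

/-- The standard set-theoretic interpretation of types: `B` is interpreted as the
two truth values (`Bool`), functional types as full function spaces. -/
def Ty.sem : Ty → Type
  | .base => Bool
  | .arrow σ τ => σ.sem → τ.sem

def Ty.semDefault : (σ : Ty) → σ.sem
  | .base => false
  | .arrow _ τ => fun _ => τ.semDefault

instance (σ : Ty) : Inhabited σ.sem := ⟨σ.semDefault⟩

noncomputable instance Ty.semFintype : (σ : Ty) → Fintype σ.sem
  | .base => inferInstanceAs (Fintype Bool)
  | .arrow σ τ =>
      letI := Ty.semFintype σ
      letI := Ty.semFintype τ
      letI := Classical.decEq σ.sem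
      inferInstanceAs (Fintype (σ.sem → τ.sem))

def Ty.semCast {σ τ : Ty} (h : σ = τ) (v : σ.sem) : τ.sem := h ▸ v

/-- An interpretation assigns to every variable a value of the corresponding type
(the constants `⊥` and `→` have their values fixed). -/
def Interp : Type := ℕ → (σ : Ty) → σ.sem

def Interp.update (I : Interp) (n : ℕ) (σ : Ty) (v : σ.sem) : Interp :=
  fun m τ => if h : m = n ∧ τ = σ then Ty.semCast h.2.symm v else I m τ

/-- Type inference. -/
def typeOf : Tm → Option Ty
  | .name x => some x.ty
  | .lam _ σ s => (typeOf s).map (Ty.arrow σ)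
  | .app s t =>
      match typeOf s, typeOf t with
      | some (.arrow σ τ), some σ' => if σ = σ' then some τ else none
      | _, _ => none

/-- The canonical extension `Î` of an interpretation to all terms: `eval I s σ`
is the value of `s` at type `σ` (on well-typed terms this is the usual
denotation; junk default values are used at type mismatches). -/
def eval (I : Interp) : Tm → (σ : Ty) → σ.sem
  | .name (.var n τ), σ => if h : τ = σ then Ty.semCast h (I n τ) else default
  | .name .bot, σ =>
      match σ with
      | .base => false
      | _ => default
  | .name .imp, σ =>
      match σ with
      | .arrow .base (.arrow .base .base) => fun a b => !a || b
      | _ => default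
  | .app s t, σ =>
      match typeOf t with
      | some τ => eval I s (.arrow τ σ) (eval I t τ)
      | none => default
  | .lam n τ s, σ =>
      match σ with
      | .base => default
      | .arrow σ₁ σ₂ =>
          if h : σ₁ = τ then
            fun a => eval (I.update n τ (Ty.semCast h a)) s σ₂
          else default

/-- `I` satisfies the formula `s` if `Î s = 1`. -/
def Satisfies (I : Interp) (s : Tm) : Prop := eval I s .base = true

/-- A formula is valid if every interpretation satisfies it. -/
def ValidFml (s : Tm) : Prop := ∀ I : Interp, Satisfies I s

/-- A sequent `A ⇒ s` is valid if every interpretation satisfying `A` satisfies `s`. -/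
def ValidSeq (A : Finset Tm) (s : Tm) : Prop :=
  ∀ I : Interp, (∀ t ∈ A, Satisfies I t) → Satisfies I s

/-- Finite disjunction (the empty disjunction is `⊥`). -/
def orList : List Tm → Tm
  | [] => botTm
  | [s] => s
  | s :: l => orTm s (orList l)

/-- Finite conjunction (the empty conjunction is `⊤`). -/
def andList : List Tm → Tm
  | [] => topTm
  | [s] => s
  | s :: l => andTm s (andList l)

/-- The argument types of a type (every type has the form `σ₁…σₙB`). -/
def Ty.args : Ty → List Ty
  | .base => []
  | .arrow σ τ => σ :: τ.args

/-- Tuples of values along a list of types. -/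
def Tup : List Ty → Type
  | [] => PUnit
  | σ :: l => σ.sem × Tup l

noncomputable instance TupFintype : (l : List Ty) → Fintype (Tup l)
  | [] => inferInstanceAs (Fintype PUnit)
  | σ :: l =>
      letI := TupFintype l
      inferInstanceAs (Fintype (σ.sem × Tup l))

/-- Applying a function value to a tuple of arguments (the result type is `B`). -/
def Ty.applyTup : (σ : Ty) → σ.sem → Tup σ.args → Bool
  | .base, a, _ => a
  | .arrow _ τ, f, p => τ.applyTup (f p.1) p.2

/-- Quote/identity data for each type in a list: a quote function and the term `≐`. -/
def ArgData : List Ty → Type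
  | [] => PUnit
  | σ :: l => ((σ.sem → Tm) × Tm) × ArgData l

/-- The conjunction list `x_k ≐_{σ_k} (↓_{σ_k} b_k), …` for a tuple `b`. -/
def eqConj : (l : List Ty) → ArgData l → ℕ → Tup l → List Tm
  | [], _, _, _ => []
  | σ :: l, (d, ds), k, (b, bs) =>
      (.app (.app d.2 (vr k σ)) (d.1 b)) :: eqConj l ds (k + 1) bs

/-- `λ x_k : σ_k. …` binding one variable for each type in the list. -/
def mkLams : (l : List Ty) → ℕ → Tm → Tm
  | [], _, body => body
  | σ :: l, k, body => .lam k σ (mkLams l (k + 1) body)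

/-- The body of the quote term
`↓_{σ₁…σₙB} a := λx₁…xₙ. ⋁_{b₁…bₙ, a b₁…bₙ = 1} ⋀_j x_j ≐_{σ_j} (↓_{σ_j} b_j)`. -/
noncomputable def quoteBodyAux (σ : Ty) (ad : ArgData σ.args) (a : σ.sem) : Tm :=
  mkLams σ.args 0 (orList
    ((((Finset.univ : Finset (Tup σ.args)).toList.filter
        (fun b => σ.applyTup a b))).map
      (fun b => andList (eqConj σ.args ad 0 b))))

/-- `∀σ := λf. ⋀_{a ∈ Bσ} f (↓σ a)`, given the quote function for `σ`. -/
noncomputable def allTmAux (σ : Ty) (q : σ.sem → Tm) : Tm :=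
  .lam 0 (.arrow σ .base)
    (andList (((Finset.univ : Finset σ.sem).toList).map
      (fun a => .app (vr 0 (.arrow σ .base)) (q a))))

mutual
  /-- The quote function `↓σ` together with the identity term `≐σ`. -/
  noncomputable def quoteEq : (σ : Ty) → ((σ.sem → Tm) × Tm)
    | .base =>
        (fun a => quoteBodyAux .base PUnit.unit a,
         .lam 0 .base (.lam 1 .base (equivTm (vr 0 .base) (vr 1 .base))))
    | .arrow σ τ =>
        (fun a => quoteBodyAux (.arrow σ τ) ((quoteEq σ, argData τ) : ArgData (σ :: τ.args)) a,
         .lam 0 (.arrow σ τ) (.lam 1 (.arrow σ τ)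
           (.app (allTmAux σ (quoteEq σ).1)
             (.lam 2 σ
               (.app (.app (quoteEq τ).2
                  (.app (vr 0 (.arrow σ τ)) (vr 2 σ)))
                (.app (vr 1 (.arrow σ τ)) (vr 2 σ)))))))
  /-- Quote/identity data for all argument types of a type. -/
  noncomputable def argData : (σ : Ty) → ArgData σ.args
    | .base => PUnit.unit
    | .arrow σ τ => ((quoteEq σ, argData τ) : ArgData (σ :: τ.args))
end

/-- The quote function `↓σ : Bσ → Λ`. -/
noncomputable def quote (σ : Ty) (a : σ.sem) : Tm := (quoteEq σ).1 a

/-- The term `≐σ : σσB` denoting the identity predicate on `Bσ`. -/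
noncomputable def eqTm (σ : Ty) : Tm := (quoteEq σ).2

/-- The term `∀σ : (σB)B`. -/
noncomputable def allTm (σ : Ty) : Tm := allTmAux σ (quote σ)


/-- Propositional formulas: `s ::= x | ⊥ | s → s` with `x` a variable of type `B`. -/
inductive Propositional : Tm → Prop
  | var (n : ℕ) : Propositional (vr n .base)
  | bot : Propositional botTm
  | imp {s t} : Propositional s → Propositional t → Propositional (impTm s t)

/-- A type-respecting substitution of terms for variables. -/
def IsSubstitution (ρ : ℕ × Ty → Tm) : Prop := ∀ n σ, HasTy (ρ (n, σ)) σ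

/-- A formula is tautologous if it is a substitution instance of a tautology
(a valid propositional formula). -/
def Tautologous (s : Tm) : Prop :=
  ∃ t ρ, Propositional t ∧ ValidFml t ∧ IsSubstitution ρ ∧ s = substAux ρ t

/-- The proof system: Triv, Weak, Ded, MP, DN, Lam and Boolean replacement (BR).
Sequents consist of a finite set of formulas and a formula. -/
inductive Ded : Finset Tm → Tm → Prop
  | triv {A s} : (∀ t ∈ A, HasTy t .base) → HasTy s .base → Ded (insert s A) s
  | weak {A s t} : HasTy s .base → Ded A t → Ded (insert s A) t
  | ded {A s t} : Ded (insert s A) t → Ded A (impTm s t)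
  | mp {A s t} : Ded A (impTm s t) → Ded A s → Ded A t
  | dn {A s} : Ded A (negTm (negTm s)) → Ded A s
  | lam {A s t} : Ded A s → LamEq s t → HasTy t .base → Ded A t
  | br {A s t} (C : Ctx) : C.Admissible A → Ded A (equivTm s t) →
      Ded A (C.fill s) → HasTy (C.fill t) .base → Ded A (C.fill t)


/-- `All_σ`: for all variables `f : σB` and `x : σ`, `{∀σ f} ⊢ f x`. -/
def AllP (σ : Ty) : Prop :=
  ∀ nf nx : ℕ,
    Ded {Tm.app (allTm σ) (vr nf (.arrow σ .base))}
      (Tm.app (vr nf (.arrow σ .base)) (vr nx σ))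

/-! ### Typing -/

theorem HasTy.typeOf_eq {s : Tm} {σ : Ty} (h : HasTy s σ) : typeOf s = some σ := by
  induction h with
  | name x => rfl
  | lam _ ih => simp [typeOf, ih]
  | app _ _ ih₁ ih₂ => simp [typeOf, ih₁, ih₂]

theorem HasTy.vr (n : ℕ) (σ : Ty) : HasTy (vr n σ) σ := HasTy.name (.var n σ)

theorem HasTy.bot : HasTy botTm .base := HasTy.name .bot

theorem HasTy.imp {s t : Tm} (hs : HasTy s .base) (ht : HasTy t .base) :
    HasTy (impTm s t) .base :=
  .app (.app (HasTy.name .imp) hs) ht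

theorem HasTy.neg {s : Tm} (hs : HasTy s .base) : HasTy (negTm s) .base := hs.imp .bot

theorem HasTy.or {s t : Tm} (hs : HasTy s .base) (ht : HasTy t .base) :
    HasTy (orTm s t) .base :=
  (hs.imp ht).imp ht

theorem HasTy.and {s t : Tm} (hs : HasTy s .base) (ht : HasTy t .base) :
    HasTy (andTm s t) .base :=
  (hs.neg.or ht.neg).neg

theorem HasTy.equiv {s t : Tm} (hs : HasTy s .base) (ht : HasTy t .base) :
    HasTy (equivTm s t) .base :=
  (hs.imp ht).and (ht.imp hs)

theorem HasTy.orList {l : List Tm} (h : ∀ s ∈ l, HasTy s .base) :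
    HasTy (orList l) .base := by
  induction l with
  | nil => exact .bot
  | cons s l ih =>
    cases l with
    | nil => exact h s (by simp)
    | cons t l => exact (h s (by simp)).or (ih fun u hu => h u (by simp [hu]))

theorem HasTy.andList {l : List Tm} (h : ∀ s ∈ l, HasTy s .base) :
    HasTy (andList l) .base := by
  induction l with
  | nil => exact HasTy.bot.imp .bot
  | cons s l ih =>
    cases l with
    | nil => exact h s (by simp)
    | cons t l => exact (h s (by simp)).and (ih fun u hu => h u (by simp [hu]))

theorem HasTy.mkLams {body : Tm} (h : HasTy body .base) (σ : Ty) (k : ℕ) :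
    HasTy (mkLams σ.args k body) σ := by
  induction σ generalizing k with
  | base => exact h
  | arrow σ τ _ ih => exact .lam (ih (k + 1))

theorem isSubstitution_update {ρ : ℕ × Ty → Tm} (hρ : IsSubstitution ρ) (n : ℕ) {σ : Ty}
    {t : Tm} (ht : HasTy t σ) : IsSubstitution (Function.update ρ (n, σ) t) := fun k υ => by
  by_cases hk : (k, υ) = (n, σ)
  · cases hk
    simpa using ht
  · simpa [Function.update_of_ne hk] using hρ k υ

theorem HasTy.substAux {s : Tm} {σ : Ty} (h : HasTy s σ) {ρ : ℕ × Ty → Tm}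
    (hρ : IsSubstitution ρ) : HasTy (substAux ρ s) σ := by
  induction h generalizing ρ with
  | name x =>
    cases x with
    | var n σ => exact hρ n σ
    | bot => exact HasTy.name .bot
    | imp => exact HasTy.name .imp
  | app _ _ ih₁ ih₂ => exact .app (ih₁ hρ) (ih₂ hρ)
  | @lam n σ s τ _ ih =>
    exact .lam (ih (isSubstitution_update hρ n (.vr _ σ)))

theorem isSubstitution_vr : IsSubstitution fun p => vr p.1 p.2 := fun n σ => .vr n σ

theorem HasTy.subst {s t : Tm} {σ τ : Ty} (hs : HasTy s τ) (n : ℕ) (ht : HasTy t σ) :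
    HasTy (subst s n σ t) τ :=
  hs.substAux (isSubstitution_update isSubstitution_vr n ht)

/-! ### Free variables -/

theorem fv_vr (n : ℕ) (σ : Ty) : fv (vr n σ) = {(n, σ)} := rfl

theorem fv_impTm (s t : Tm) : fv (impTm s t) = fv s ∪ fv t := by
  simp [impTm, fv]

theorem fv_negTm (s : Tm) : fv (negTm s) = fv s := by
  simp [negTm, fv_impTm, botTm, fv]

theorem fv_orTm (s t : Tm) : fv (orTm s t) = fv s ∪ fv t := by
  simp [orTm, fv_impTm, Finset.union_assoc]

theorem fv_andTm (s t : Tm) : fv (andTm s t) = fv s ∪ fv t := by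
  simp [andTm, fv_negTm, fv_orTm]

theorem fv_orList_subset {l : List Tm} {V : Finset (ℕ × Ty)} (h : ∀ s ∈ l, fv s ⊆ V) :
    fv (orList l) ⊆ V := by
  induction l with
  | nil => simp [orList, botTm, fv]
  | cons s l ih =>
    cases l with
    | nil => exact h s (by simp)
    | cons t l =>
      rw [orList, fv_orTm]
      · exact Finset.union_subset (h s (by simp)) (ih fun u hu => h u (by simp [hu]))
      · simp

theorem fv_andList_subset {l : List Tm} {V : Finset (ℕ × Ty)} (h : ∀ s ∈ l, fv s ⊆ V) :
    fv (andList l) ⊆ V := by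
  induction l with
  | nil => simp [andList, topTm, fv_impTm, botTm, fv]
  | cons s l ih =>
    cases l with
    | nil => exact h s (by simp)
    | cons t l =>
      rw [andList, fv_andTm]
      · exact Finset.union_subset (h s (by simp)) (ih fun u hu => h u (by simp [hu]))
      · simp

/-- The variables bound by `mkLams l k`. -/
def lamVars : List Ty → ℕ → Finset (ℕ × Ty)
  | [], _ => ∅
  | σ :: l, k => insert (k, σ) (lamVars l (k + 1))

theorem fv_mkLams (l : List Ty) (k : ℕ) (s : Tm) : fv (mkLams l k s) = fv s \ lamVars l k := by
  induction l generalizing k with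
  | nil => simp [mkLams, lamVars]
  | cons σ l ih =>
    ext p
    simp only [mkLams, lamVars, fv, ih, Finset.mem_erase, Finset.mem_sdiff, Finset.mem_insert]
    tauto

theorem substAux_fresh (ρ : ℕ × Ty → Tm) (n : ℕ) (σ : Ty) (s : Tm) :
    ∃ m, substAux ρ (.lam n σ s) = .lam m σ (substAux (Function.update ρ (n, σ) (vr m σ)) s) ∧
      ∀ p ∈ fv s, p ≠ (n, σ) → (m, σ) ∉ fv (ρ p) := by
  refine ⟨_, rfl, fun p hp hne hmem => ?_⟩
  set U := ((fv s).erase (n, σ)).biUnion fun p => (fv (ρ p)).image Prod.fst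
  have : U.sup id + 1 ≤ U.sup id :=
    Finset.le_sup (f := id) (Finset.mem_biUnion.2
      ⟨p, Finset.mem_erase.2 ⟨hne, hp⟩, Finset.mem_image.2 ⟨_, hmem, rfl⟩⟩)
  omega

theorem fv_substAux (ρ : ℕ × Ty → Tm) (s : Tm) :
    fv (substAux ρ s) = (fv s).biUnion fun p => fv (ρ p) := by
  induction s generalizing ρ with
  | name x => cases x <;> simp [substAux, fv]
  | app s t ih₁ ih₂ => simp [substAux, fv, ih₁, ih₂, Finset.union_biUnion]
  | lam n σ s ih =>
    obtain ⟨m, hm, hfresh⟩ := substAux_fresh ρ n σ s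
    rw [hm]
    simp only [fv, ih]
    ext q
    simp only [Finset.mem_erase, Finset.mem_biUnion]
    constructor
    · rintro ⟨hq, p, hp, hqp⟩
      by_cases hne : p = (n, σ)
      · subst hne
        simp [fv_vr] at hqp
        exact absurd hqp hq
      · rw [Function.update_of_ne hne] at hqp
        exact ⟨p, ⟨hne, hp⟩, hqp⟩
    · rintro ⟨p, ⟨hne, hp⟩, hqp⟩
      refine ⟨?_, p, hp, by rwa [Function.update_of_ne hne]⟩
      rintro rfl
      exact hfresh p hp hne hqp

/-! ### Quotes, identities and quantifiers are closed and well typed -/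

/-- `t` is a closed term of type `σ`. -/
def ClosedOf (t : Tm) (σ : Ty) : Prop := HasTy t σ ∧ fv t = ∅

/-- The terms in `ArgData` are closed and have the expected types. -/
def ArgData.WellTyped : (l : List Ty) → ArgData l → Prop
  | [], _ => True
  | σ :: l, (d, ds) =>
    ((∀ a, ClosedOf (d.1 a) σ) ∧ ClosedOf d.2 (.arrow σ (.arrow σ .base))) ∧
      ArgData.WellTyped l ds

theorem ArgData.WellTyped.eqConj {l : List Ty} {ad : ArgData l} (h : ad.WellTyped) (k : ℕ)
    (b : Tup l) : ∀ s ∈ eqConj l ad k b, HasTy s .base ∧ fv s ⊆ lamVars l k := by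
  induction l generalizing k with
  | nil => simp [PTT.eqConj]
  | cons σ l ih =>
    obtain ⟨d, ds⟩ := ad
    obtain ⟨b, bs⟩ := b
    obtain ⟨⟨hq, he⟩, hds⟩ := h
    intro s hs
    rcases List.mem_cons.1 hs with rfl | hs
    · exact ⟨.app (.app he.1 (.vr k σ)) (hq b).1, by
        simp [fv, he.2, (hq b).2, fv_vr, lamVars]⟩
    · obtain ⟨h₁, h₂⟩ := ih hds (k + 1) bs s hs
      exact ⟨h₁, h₂.trans (Finset.subset_insert _ _)⟩

theorem ArgData.WellTyped.quoteBodyAux {σ : Ty} {ad : ArgData σ.args}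
    (h : ad.WellTyped) (a : σ.sem) : ClosedOf (quoteBodyAux σ ad a) σ := by
  refine ⟨HasTy.mkLams (HasTy.orList fun s hs => ?_) σ 0, ?_⟩
  · obtain ⟨b, -, rfl⟩ := List.mem_map.1 hs
    exact HasTy.andList fun s hs => (h.eqConj 0 b s hs).1
  · rw [PTT.quoteBodyAux, fv_mkLams, Finset.sdiff_eq_empty_iff_subset]
    refine fv_orList_subset fun s hs => ?_
    obtain ⟨b, -, rfl⟩ := List.mem_map.1 hs
    exact fv_andList_subset fun s hs => (h.eqConj 0 b s hs).2

theorem closedOf_allTmAux {σ : Ty} {q : σ.sem → Tm} (hq : ∀ a, ClosedOf (q a) σ) :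
    ClosedOf (allTmAux σ q) (.arrow (.arrow σ .base) .base) := by
  refine ⟨.lam (HasTy.andList fun s hs => ?_), ?_⟩
  · obtain ⟨a, -, rfl⟩ := List.mem_map.1 hs
    exact .app (.vr _ _) (hq a).1
  · rw [allTmAux, fv, Finset.erase_eq_empty_iff, ← Finset.subset_singleton_iff]
    refine fv_andList_subset fun s hs => ?_
    obtain ⟨a, -, rfl⟩ := List.mem_map.1 hs
    simp [fv, fv_vr, (hq a).2]

theorem closedOf_quoteEq_and_argData (σ : Ty) :
    ((∀ a, ClosedOf ((quoteEq σ).1 a) σ) ∧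
      ClosedOf (quoteEq σ).2 (.arrow σ (.arrow σ .base))) ∧ (argData σ).WellTyped := by
  induction σ with
  | base =>
    refine ⟨⟨fun a => ?_, ?_⟩, trivial⟩
    · rw [quoteEq]
      exact ArgData.WellTyped.quoteBodyAux (σ := .base) trivial a
    · rw [quoteEq]
      refine ⟨.lam (.lam (.equiv (.vr _ _) (.vr _ _))), ?_⟩
      simp only [fv, equivTm, fv_andTm, fv_impTm, fv_vr]
      decide
  | arrow σ τ ihσ ihτ =>
    have had : (argData (.arrow σ τ)).WellTyped := by
      rw [argData]
      exact ⟨ihσ.1, ihτ.2⟩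
    refine ⟨⟨fun a => ?_, ?_⟩, had⟩
    · rw [argData] at had
      rw [quoteEq]
      exact had.quoteBodyAux a
    · have hall := closedOf_allTmAux ihσ.1.1
      rw [quoteEq]
      refine ⟨.lam (.lam (.app hall.1 (.lam (.app (.app ihτ.1.2.1 (.app (.vr _ _) (.vr _ _)))
        (.app (.vr _ _) (.vr _ _)))))), ?_⟩
      ext p
      simp only [fv, hall.2, ihτ.1.2.2, fv_vr, Finset.mem_erase, Finset.mem_union,
        Finset.mem_singleton, Finset.notMem_empty]
      tauto

theorem closedOf_quote (σ : Ty) (a : σ.sem) : ClosedOf (quote σ a) σ :=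
  (closedOf_quoteEq_and_argData σ).1.1 a

theorem closedOf_allTm (σ : Ty) : ClosedOf (allTm σ) (.arrow (.arrow σ .base) .base) :=
  closedOf_allTmAux (closedOf_quote σ)

/-! ### Substitution -/

theorem substAux_congr {ρ ρ' : ℕ × Ty → Tm} {s : Tm} (h : ∀ p ∈ fv s, ρ p = ρ' p) :
    substAux ρ s = substAux ρ' s := by
  induction s generalizing ρ ρ' with
  | name x =>
    cases x with
    | var n σ => exact h (n, σ) (by simp [fv])
    | _ => rfl
  | app s t ih₁ ih₂ =>
    simp only [substAux]
    rw [ih₁ fun p hp => h p (by simp [fv, hp]), ih₂ fun p hp => h p (by simp [fv, hp])]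
  | lam n σ s ih =>
    simp only [substAux]
    have hused : (((fv s).erase (n, σ)).biUnion fun p => (fv (ρ p)).image Prod.fst) =
        ((fv s).erase (n, σ)).biUnion fun p => (fv (ρ' p)).image Prod.fst :=
      Finset.biUnion_congr rfl fun p hp => by rw [h p hp]
    rw [hused]
    congr 1
    refine ih fun p hp => ?_
    by_cases hne : p = (n, σ)
    · subst hne
      simp
    · rw [Function.update_of_ne hne, Function.update_of_ne hne]
      exact h p (Finset.mem_erase.2 ⟨hne, hp⟩)

theorem substAux_substAux (ρ ρ' : ℕ × Ty → Tm) (s : Tm) :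
    substAux ρ' (substAux ρ s) = substAux (fun p => substAux ρ' (ρ p)) s := by
  induction s generalizing ρ ρ' with
  | name x => cases x <;> rfl
  | app s t ih₁ ih₂ => simp only [substAux, ih₁, ih₂]
  | lam n σ s ih =>
    obtain ⟨m, hm, hfresh⟩ := substAux_fresh ρ n σ s
    have hfv : (fv (substAux (Function.update ρ (n, σ) (vr m σ)) s)).erase (m, σ) =
        ((fv s).erase (n, σ)).biUnion fun p => fv (ρ p) := by
      have := fv_substAux ρ (.lam n σ s)
      rwa [hm] at this
    rw [hm]
    simp only [substAux]
    rw [hfv, Finset.biUnion_biUnion, ih]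
    simp only [fv_substAux, Finset.biUnion_image]
    congr 1
    refine substAux_congr fun p hp => ?_
    by_cases hne : p = (n, σ)
    · subst hne
      simp [vr, substAux]
    · rw [Function.update_of_ne hne, Function.update_of_ne hne]
      refine substAux_congr fun q hq => Function.update_of_ne ?_ _ _
      rintro rfl
      exact hfresh p hp hne hq

theorem LamEq.substAux_vr {s : Tm} {σ : Ty} (h : HasTy s σ) :
    LamEq (substAux (fun p => vr p.1 p.2) s) s := by
  induction h with
  | name x => cases x <;> exact .refl (HasTy.name _)
  | @app s t σ τ hs ht ih₁ ih₂ =>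
    have hs' := hs.substAux isSubstitution_vr
    have ht' := ht.substAux isSubstitution_vr
    exact (LamEq.ctx (.appL .hole _) ih₁ (.app hs' ht')).trans
      (LamEq.ctx (.appR _ .hole) ih₂ (.app hs ht'))
  | @lam n σ s τ hs ih =>
    obtain ⟨m, hm, hfresh⟩ := substAux_fresh (fun p => vr p.1 p.2) n σ s
    rw [hm]
    by_cases hmn : m = n
    · subst hmn
      rw [Function.update_eq_self_iff.2 rfl]
      exact LamEq.ctx (.lam m σ .hole) ih (.lam (hs.substAux isSubstitution_vr))
    · refine (LamEq.alpha (.lam hs) fun hmem => ?_).symm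
      exact hfresh (m, σ) hmem (by simpa using hmn) (by simp [fv_vr])

theorem substAux_eq_of_closed {s : Tm} (h : fv s = ∅) (ρ ρ' : ℕ × Ty → Tm) :
    substAux ρ s = substAux ρ' s :=
  substAux_congr (by simp [h])

/-! ### The logical relation between terms and values -/

/-- The logical relation between terms and values generated by provability and refutability. -/
def Rel : (σ : Ty) → Tm → σ.sem → Prop
  | .base, s, a => Ded ∅ (bif a then s else negTm s)
  | .arrow σ τ, s, f => ∀ (t : Tm) (a : σ.sem), HasTy t σ → Rel σ t a → Rel τ (.app s t) (f a)

theorem Rel.lamEq {σ : Ty} {s t : Tm} {a : σ.sem} (h : Rel σ s a) (hst : LamEq s t)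
    (hs : HasTy s σ) (ht : HasTy t σ) : Rel σ t a := by
  induction σ generalizing s t with
  | base =>
    change Bool at a
    cases a with
    | true => exact Ded.lam h hst ht
    | false =>
      exact Ded.lam h (LamEq.ctx (.appL (.appR (.name .imp) .hole) botTm) hst hs.neg) ht.neg
  | arrow σ τ _ ih =>
    exact fun u a hu hua =>
      ih (h u a hu hua) (LamEq.ctx (.appL .hole u) hst (.app hs hu)) (.app hs hu) (.app ht hu)

theorem Rel.bot : Rel .base botTm false := Ded.ded (.triv (by simp) .bot)

theorem Rel.imp {s t : Tm} {a b : Bool} (hs : HasTy s .base) (ht : HasTy t .base)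
    (hsa : Rel .base s a) (htb : Rel .base t b) : Rel .base (impTm s t) (!a || b) := by
  cases b with
  | true => simpa [Rel] using Ded.ded (.weak hs htb)
  | false =>
    cases a with
    | true =>
      refine Ded.ded ?_
      have hst : HasTy (impTm s t) .base := hs.imp ht
      exact .mp (.weak hst htb) (.mp (.triv (by simp) hst) (.weak hst hsa))
    | false =>
      refine Ded.ded (.dn (.ded (.weak ht.neg ?_)))
      exact .mp (.weak hs hsa) (.triv (by simp) hs)

theorem Rel.neg {s : Tm} {a : Bool} (hs : HasTy s .base) (h : Rel .base s a) :
    Rel .base (negTm s) (!a) := by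
  cases a <;> exact h.imp hs .bot .bot

theorem Ded.and {s t : Tm} (hs : HasTy s .base) (ht : HasTy t .base)
    (h₁ : Ded ∅ s) (h₂ : Ded ∅ t) : Ded ∅ (andTm s t) := by
  have hs₁ : Rel .base s true := h₁
  have ht₁ : Rel .base t true := h₂
  exact Rel.neg (hs.neg.or ht.neg)
    (Rel.imp (hs.neg.imp ht.neg) ht.neg (.imp hs.neg ht.neg (hs₁.neg hs) (ht₁.neg ht)) (ht₁.neg ht))

theorem Ded.top : Ded ∅ topTm := .ded (.triv (by simp) .bot)

/-- Deducible formulas are closed under substitution. -/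
theorem Ded.subst {s t : Tm} {σ : Ty} (h : Ded ∅ s) (hs : HasTy s .base) (n : ℕ)
    (ht : HasTy t σ) : Ded ∅ (subst s n σ t) := by
  have htop : HasTy topTm .base := HasTy.bot.imp .bot
  have hequiv : Ded ∅ (equivTm topTm s) :=
    .and (htop.imp hs) (hs.imp htop) (.ded (.weak htop h)) (.ded (.weak hs .top))
  have hred : Ded ∅ (.app (.lam n σ topTm) t) :=
    .lam .top (LamEq.beta (.app (.lam htop) ht)).symm (.app (.lam htop) ht)
  have hexp : Ded ∅ (.app (.lam n σ s) t) :=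
    .br (.appL (.lam n σ .hole) t) (by simp [Ctx.Admissible]) hequiv hred (.app (.lam hs) ht)
  exact .lam hexp (.beta (.app (.lam hs) ht)) (hs.subst n ht)

theorem Interp.update_self (I : Interp) (n : ℕ) (σ : Ty) (a : σ.sem) :
    I.update n σ a n σ = a := by
  simp [Interp.update, Ty.semCast]

theorem Interp.update_of_ne (I : Interp) {n m : ℕ} {σ τ : Ty} (a : σ.sem)
    (h : (m, τ) ≠ (n, σ)) : I.update n σ a m τ = I m τ :=
  dif_neg (by simpa using h)

theorem eval_app {I : Interp} {s t : Tm} {σ τ : Ty} (ht : HasTy t σ) :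
    eval I (.app s t) τ = eval I s (.arrow σ τ) (eval I t σ) := by
  change (match typeOf t with
    | some υ => eval I s (.arrow υ τ) (eval I t υ)
    | none => default) = _
  rw [ht.typeOf_eq]

theorem eval_lam (I : Interp) (n : ℕ) (σ τ : Ty) (s : Tm) :
    eval I (.lam n σ s) (.arrow σ τ) = fun a => eval (I.update n σ a) s τ := by
  exact dif_pos rfl

theorem eval_vr (I : Interp) (n : ℕ) (σ : Ty) : eval I (vr n σ) σ = I n σ :=
  dif_pos rfl

/-- The fundamental lemma: substituting related terms into a term yields a term related to
its denotation. -/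
theorem Rel.substAux {s : Tm} {σ : Ty} (h : HasTy s σ) {ρ : ℕ × Ty → Tm}
    (hρ : IsSubstitution ρ) {I : Interp}
    (hI : ∀ p ∈ fv s, Rel p.2 (ρ p) (I p.1 p.2)) : Rel σ (substAux ρ s) (eval I s σ) := by
  induction h generalizing ρ I with
  | name x =>
    cases x with
    | var n σ =>
      rw [show eval I (.name (.var n σ)) (Name.var n σ).ty = I n σ from eval_vr I n σ]
      exact hI (n, σ) (by simp [fv])
    | bot => exact .bot
    | imp => exact fun s a hs hsa t b ht htb => Rel.imp hs ht hsa htb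
  | app hs ht ih₁ ih₂ =>
    rw [eval_app ht]
    exact ih₁ hρ (fun p hp => hI p (by simp [fv, hp])) _ _ (ht.substAux hρ)
      (ih₂ hρ fun p hp => hI p (by simp [fv, hp]))
  | @lam n σ s τ hs ih =>
    intro t a ht hta
    obtain ⟨m, hm, hfresh⟩ := substAux_fresh ρ n σ s
    rw [hm, eval_lam]
    have hbody := hs.substAux (isSubstitution_update hρ n (.vr m σ))
    have hθ := isSubstitution_update isSubstitution_vr m ht
    refine Rel.lamEq ?_ (LamEq.beta (.app (.lam hbody) ht)).symm (hbody.subst m ht)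
      (.app (.lam hbody) ht)
    rw [PTT.subst, substAux_substAux]
    refine ih (fun k υ => (isSubstitution_update hρ n (.vr m σ) k υ).substAux hθ) fun p hp => ?_
    by_cases hne : p = (n, σ)
    · subst hne
      simpa [vr, PTT.substAux, Interp.update_self] using hta
    · rw [Function.update_of_ne hne, Interp.update_of_ne _ _ hne]
      have hcongr : PTT.substAux (Function.update (fun p => vr p.1 p.2) (m, σ) t) (ρ p) =
          PTT.substAux (fun p => vr p.1 p.2) (ρ p) :=
        substAux_congr fun q hq => Function.update_of_ne (by
          rintro rfl
          exact hfresh p hp hne hq) _ _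
      have hp' := hρ p.1 p.2
      rw [hcongr]
      exact (hI p (Finset.mem_erase.2 ⟨hne, hp⟩)).lamEq (LamEq.substAux_vr hp').symm hp'
        (hp'.substAux isSubstitution_vr)

/-- Completeness for closed formulas. -/
theorem ded_of_closed {s : Tm} (hs : ClosedOf s .base) (h : ValidFml s) : Ded ∅ s := by
  have hrel := Rel.substAux (I := fun _ _ => default) hs.1 isSubstitution_vr (by simp [hs.2])
  rw [show eval (fun _ _ => default) s .base = true from h _] at hrel
  exact .lam hrel (.substAux_vr hs.1) hs.1

/-! ### Eliminating free variables -/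

theorem eval_impTm {I : Interp} {s t : Tm} (hs : HasTy s .base) (ht : HasTy t .base) :
    eval I (impTm s t) .base = (!(eval I s .base : Bool) || (eval I t .base : Bool)) := by
  rw [impTm, eval_app ht, eval_app hs]
  rfl

theorem Satisfies.and {I : Interp} {s t : Tm} (hs : HasTy s .base) (ht : HasTy t .base)
    (h₁ : Satisfies I s) (h₂ : Satisfies I t) : Satisfies I (andTm s t) := by
  unfold Satisfies at *
  rw [andTm, negTm, eval_impTm (hs.neg.or ht.neg) .bot, orTm,
    eval_impTm (hs.neg.imp ht.neg) ht.neg, eval_impTm hs.neg ht.neg, negTm, negTm,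
    eval_impTm hs .bot, eval_impTm ht .bot, h₁, h₂]
  rfl

theorem Satisfies.andList {I : Interp} {l : List Tm} (hl : ∀ s ∈ l, HasTy s .base)
    (h : ∀ s ∈ l, Satisfies I s) : Satisfies I (andList l) := by
  induction l with
  | nil => rw [PTT.andList, Satisfies, topTm, eval_impTm .bot .bot]; rfl
  | cons s l ih =>
    cases l with
    | nil => exact h s (by simp)
    | cons t l =>
      exact .and (hl s (by simp)) (HasTy.andList fun u hu => hl u (by simp_all))
        (h s (by simp)) (ih (fun u hu => hl u (by simp_all)) fun u hu => h u (by simp_all))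

theorem ValidFml.all {s : Tm} (hs : HasTy s .base) (h : ValidFml s) (n : ℕ) (σ : Ty) :
    ValidFml (.app (allTm σ) (.lam n σ s)) := by
  intro I
  rw [Satisfies, eval_app (.lam hs), allTm, allTmAux, eval_lam]
  refine Satisfies.andList (fun t ht => ?_) fun t ht => ?_
  · obtain ⟨a, -, rfl⟩ := List.mem_map.1 ht
    exact .app (.vr _ _) (closedOf_quote σ a).1
  · obtain ⟨a, -, rfl⟩ := List.mem_map.1 ht
    rw [Satisfies, eval_app (closedOf_quote σ a).1]
    rw [eval_vr, Interp.update_self, eval_lam]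
    exact h _

theorem Ty.ne_arrow (σ τ : Ty) : σ ≠ .arrow σ τ := fun h => by
  have := congrArg sizeOf h
  simp at this
  omega

theorem AllP.elim {σ : Ty} (hAll : AllP σ) {s : Tm} (hs : HasTy s .base) (n : ℕ)
    (h : Ded ∅ (.app (allTm σ) (.lam n σ s))) : Ded ∅ s := by
  have hall := closedOf_allTm σ
  have hlam : HasTy (.lam n σ s) (.arrow σ .base) := .lam hs
  have hinst := (Ded.ded (hAll 0 n)).subst
    (.imp (.app hall.1 (.vr _ _)) (.app (.vr _ _) (.vr _ _))) 0 hlam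
  have hne : (n, σ) ≠ (0, Ty.arrow σ .base) := fun he => σ.ne_arrow _ (congrArg Prod.snd he)
  simp only [PTT.subst, impTm, substAux, vr, Function.update_self,
    Function.update_of_ne hne] at hinst
  rw [substAux_eq_of_closed hall.2 _ fun p => vr p.1 p.2] at hinst
  have hall' := hall.1.substAux isSubstitution_vr
  have hprem : Ded ∅ (.app (substAux (fun p => vr p.1 p.2) (allTm σ)) (.lam n σ s)) :=
    .lam h (LamEq.ctx (.appL .hole _) (LamEq.substAux_vr hall.1).symm (.app hall.1 hlam))
      (.app hall' hlam)
  have hbeta := LamEq.beta (.app hlam (.vr n σ))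
  rw [PTT.subst, Function.update_eq_self_iff.2 rfl] at hbeta
  exact .lam (.mp hinst hprem) (hbeta.trans (.substAux_vr hs)) hs

/-- if `All_σ` holds for all types `σ`, then the proof system is
complete: every valid formula is deducible. -/
theorem all_implies_complete (hAll : ∀ σ : Ty, AllP σ) :
    ∀ s : Tm, HasTy s .base → ValidFml s → Ded ∅ s := by
  have hclose : ∀ (V : Finset (ℕ × Ty)) (s : Tm), HasTy s .base → ValidFml s →
      fv s ⊆ V → Ded ∅ s := fun V => by
    induction V using Finset.induction_on with
    | empty => exact fun s hs hv hfv => ded_of_closed ⟨hs, Finset.subset_empty.1 hfv⟩ hv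
    | insert p V _ ih =>
      obtain ⟨n, σ⟩ := p
      refine fun s hs hv hfv => (hAll σ).elim hs n (ih _ ?_ (hv.all hs n σ) ?_)
      · exact .app (closedOf_allTm σ).1 (.lam hs)
      · simpa [fv, (closedOf_allTm σ).2, Finset.subset_insert_iff] using hfv
  exact fun s hs hv => hclose _ s hs hv subset_rfl

end PTT
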